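/- For every integer m ≥ 2, d(m, 2m + 17) ≤ 11692; that is, there exists an integral point set of 2m + 17 points in m-dimensional Euclidean space ℝ^m whose diameter is at most 11692. -/

import Mathlib

open Finset

/-- The point of `ℝ^(n+1)` with first coordinate `t` and all other coordinates `c`. -/
noncomputable def axisPoint (n : ℕ) (c t : ℝ) : EuclideanSpace ℝ (Fin (n + 1)) :=
  WithLp.toLp 2 (Fin.cons t (fun _ => c))

/-- The point of `ℝ^(n+1)` with first coordinate `s` and the `i`-th of the remaining
coordinates equal to `b`. -/
noncomputable def prismPoint (n : ℕ) (b s : ℝ) (i : Fin n) : EuclideanSpace ℝ (Fin (n + 1)) :=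
  WithLp.toLp 2 (Fin.cons s (Pi.single i b))

lemma dist_axisPoint_sq (n : ℕ) (c t t' : ℝ) :
    dist (axisPoint n c t) (axisPoint n c t') ^ 2 = (t - t') ^ 2 := by
  simp [axisPoint, EuclideanSpace.dist_sq_eq, Fin.sum_univ_succ, Real.dist_eq]

lemma sum_single_sub_const_sq {n : ℕ} (b c : ℝ) (i : Fin n) :
    ∑ j, (c - (Pi.single i b : Fin n → ℝ) j) ^ 2 = n * c ^ 2 - 2 * b * c + b ^ 2 := by
  have h : ∀ j, (c - (Pi.single i b : Fin n → ℝ) j) ^ 2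
      = c ^ 2 + (Pi.single i (b ^ 2 - 2 * b * c) : Fin n → ℝ) j := by
    intro j
    by_cases hj : j = i
    · subst hj
      simp
      ring
    · simp [hj]
  simp only [h, sum_add_distrib, sum_const, card_univ, Fintype.card_fin, nsmul_eq_mul,
    Finset.sum_pi_single', mem_univ, if_true]
  ring

lemma dist_axisPoint_prismPoint_sq (n : ℕ) (b c t s : ℝ) (i : Fin n) :
    dist (axisPoint n c t) (prismPoint n b s i) ^ 2
      = (t - s) ^ 2 + (n * c ^ 2 - 2 * b * c + b ^ 2) := by
  simp [axisPoint, prismPoint, EuclideanSpace.dist_sq_eq, Fin.sum_univ_succ, Real.dist_eq,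
    sum_single_sub_const_sq]

lemma dist_prismPoint_same_sq (n : ℕ) (b s s' : ℝ) (i : Fin n) :
    dist (prismPoint n b s i) (prismPoint n b s' i) ^ 2 = (s - s') ^ 2 := by
  simp [prismPoint, EuclideanSpace.dist_sq_eq, Fin.sum_univ_succ, Real.dist_eq]

lemma dist_prismPoint_of_ne_sq (n : ℕ) (b s s' : ℝ) {i j : Fin n} (hij : i ≠ j) :
    dist (prismPoint n b s i) (prismPoint n b s' j) ^ 2 = (s - s') ^ 2 + 2 * b ^ 2 := by
  have h : ∀ k, ((Pi.single i b : Fin n → ℝ) k - (Pi.single j b : Fin n → ℝ) k) ^ 2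
      = (Pi.single i (b ^ 2) : Fin n → ℝ) k + (Pi.single j (b ^ 2) : Fin n → ℝ) k := by
    intro k
    by_cases hi : k = i
    · subst hi
      simp [hij]
    · by_cases hj : k = j
      · subst hj
        simp [hi]
      · simp [hi, hj]
  simp [prismPoint, EuclideanSpace.dist_sq_eq, Fin.sum_univ_succ, Real.dist_eq, h,
    sum_add_distrib]
  ring

/-- A set containing two points of the axis and one base of the prism affinely spans the
space as soon as the axis misses the hyperplane of the facet (`n * c ≠ b`). -/
lemma affineSpan_eq_top_of_axisPoint_prismPoint {n : ℕ} {b c t t' s : ℝ} (hb : b ≠ 0)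
    (hc : n * c ≠ b) (ht : t ≠ t') {S : Set (EuclideanSpace ℝ (Fin (n + 1)))}
    (h₁ : axisPoint n c t ∈ S) (h₂ : axisPoint n c t' ∈ S)
    (h₃ : ∀ i, prismPoint n b s i ∈ S) : affineSpan ℝ S = ⊤ := by
  rw [AffineSubspace.affineSpan_eq_top_iff_vectorSpan_eq_top_of_nonempty ℝ _ _ ⟨_, h₁⟩,
    ← Submodule.orthogonal_eq_bot_iff, Submodule.eq_bot_iff]
  intro v hv
  rw [Submodule.mem_orthogonal] at hv
  have hv0 : v 0 = 0 := by
    have h := hv _ (vsub_mem_vectorSpan ℝ h₁ h₂)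
    simp [axisPoint, PiLp.inner_apply, Fin.sum_univ_succ] at h
    exact h.resolve_right (sub_ne_zero.mpr ht)
  have hvi : ∀ i : Fin n, b * v i.succ = c * ∑ j : Fin n, v j.succ := by
    intro i
    have h := hv _ (vsub_mem_vectorSpan ℝ (h₃ i) h₁)
    simp [axisPoint, prismPoint, PiLp.inner_apply, Fin.sum_univ_succ, hv0, mul_sub,
      sum_sub_distrib, Pi.single_apply] at h
    rw [mul_sum]
    simp only [mul_comm] at h ⊢
    linarith
  have hsum : ∑ j : Fin n, v j.succ = 0 := by
    have h : b * ∑ j : Fin n, v j.succ = n * (c * ∑ j : Fin n, v j.succ) := by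
      rw [mul_sum, sum_congr rfl fun i _ => hvi i]
      simp
    have h' : (n * c - b) * ∑ j : Fin n, v j.succ = 0 := by linarith
    exact (mul_eq_zero.mp h').resolve_left (sub_ne_zero.mpr hc)
  ext k
  refine Fin.cases hv0 (fun i => ?_) k
  have h := hvi i
  rw [hsum, mul_zero] at h
  exact (mul_eq_zero.mp h).resolve_left hb

/-- Some diagonal point of `ℝ^n` has squared distance `D` from all points `b • eᵢ` and lies
off the hyperplane they span, provided `b ^ 2 < D`. -/
lemma exists_equidistant_diagonal {n : ℕ} (hn : 0 < n) {b D : ℝ} (hD : b ^ 2 < D) :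
    ∃ c : ℝ, n * c ≠ b ∧ n * c ^ 2 - 2 * b * c + b ^ 2 = D := by
  have hn' : (0 : ℝ) < n := by exact_mod_cast hn
  have hpos : 0 < b ^ 2 + n * (D - b ^ 2) := by
    have := mul_pos hn' (sub_pos.mpr hD)
    positivity
  refine ⟨(b + √(b ^ 2 + n * (D - b ^ 2))) / n, ?_, ?_⟩
  · rw [mul_div_cancel₀ _ hn'.ne']
    have := Real.sqrt_pos.mpr hpos
    linarith
  · have hs := Real.sq_sqrt hpos.le
    field_simp
    linear_combination hs

/-- Positions of the collinear points. -/
def axisHeight : Fin 19 → ℤ :=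
  ![-3526, -2922, -1506, -486, -75, 75, 783, 894, 1718, 2322, 2922, 3526, 4350, 4461, 5169,
    5319, 5730, 6750, 8166]

/-- Heights of the two bases of the prism. -/
def prismHeight : Fin 2 → ℤ := ![0, 5244]

lemma axisHeight_dist (i j : Fin 19) (hij : i ≠ j) :
    ∃ z : ℕ, 0 < z ∧ z ≤ 11692 ∧ (axisHeight i - axisHeight j) ^ 2 = (z : ℤ) ^ 2 := by
  have h : ∀ i j : Fin 19, i ≠ j → 0 < (axisHeight i - axisHeight j).natAbs ∧
      (axisHeight i - axisHeight j).natAbs ≤ 11692 := by decide +kernel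
  exact ⟨_, (h i j hij).1, (h i j hij).2, (Int.natAbs_sq _).symm⟩

lemma axisHeight_prismHeight_dist (i : Fin 19) (k : Fin 2) :
    ∃ z : ℕ, 0 < z ∧ z ≤ 11692 ∧
      (axisHeight i - prismHeight k) ^ 2 + 4989600 = (z : ℤ) ^ 2 := by
  have h : ∀ (i : Fin 19) (k : Fin 2),
      let z := Nat.sqrt ((axisHeight i - prismHeight k) ^ 2 + 4989600).toNat
      0 < z ∧ z ≤ 11692 ∧ (axisHeight i - prismHeight k) ^ 2 + 4989600 = (z : ℤ) ^ 2 := by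
    decide +kernel
  exact ⟨_, h i k⟩

lemma prismHeight_dist_same (k l : Fin 2) (hkl : k ≠ l) :
    (prismHeight k - prismHeight l) ^ 2 = 5244 ^ 2 := by
  revert k l
  decide

lemma prismHeight_dist_of_ne (k l : Fin 2) :
    ∃ z : ℕ, 0 < z ∧ z ≤ 11692 ∧
      (prismHeight k - prismHeight l) ^ 2 + 1008 ^ 2 = (z : ℤ) ^ 2 := by
  by_cases hkl : k = l
  · exact ⟨1008, by norm_num, by norm_num, by simp [hkl]⟩
  · exact ⟨5340, by norm_num, by norm_num, by rw [prismHeight_dist_same k l hkl]; norm_num⟩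

/-- The full configuration: `19` collinear points together with the `2 * n` vertices of a
prism over a regular simplex. -/
noncomputable def configuration (n : ℕ) (b c : ℝ) :
    Fin 19 ⊕ (Fin n × Fin 2) → EuclideanSpace ℝ (Fin (n + 1))
  | .inl i => axisPoint n c (axisHeight i)
  | .inr (i, k) => prismPoint n b (prismHeight k) i

lemma configuration_dist_sq {n : ℕ} {b c : ℝ} (hb : 2 * b ^ 2 = 1008 ^ 2)
    (hc : n * c ^ 2 - 2 * b * c + b ^ 2 = 4989600) (x y : Fin 19 ⊕ (Fin n × Fin 2))
    (hxy : x ≠ y) :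
    ∃ z : ℕ, 0 < z ∧ z ≤ 11692 ∧
      dist (configuration n b c x) (configuration n b c y) ^ 2 = (z : ℝ) ^ 2 := by
  rcases x with i | ⟨i, k⟩ <;> rcases y with j | ⟨j, l⟩
  · obtain ⟨z, hz, hz', h⟩ := axisHeight_dist i j (by simpa using hxy)
    refine ⟨z, hz, hz', ?_⟩
    rw [configuration, configuration, dist_axisPoint_sq]
    exact_mod_cast h
  · obtain ⟨z, hz, hz', h⟩ := axisHeight_prismHeight_dist i l
    refine ⟨z, hz, hz', ?_⟩
    rw [configuration, configuration, dist_axisPoint_prismPoint_sq, hc]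
    exact_mod_cast h
  · obtain ⟨z, hz, hz', h⟩ := axisHeight_prismHeight_dist j k
    refine ⟨z, hz, hz', ?_⟩
    rw [configuration, configuration, dist_comm, dist_axisPoint_prismPoint_sq, hc]
    exact_mod_cast h
  · by_cases hij : i = j
    · subst hij
      refine ⟨5244, by norm_num, by norm_num, ?_⟩
      rw [configuration, configuration, dist_prismPoint_same_sq]
      exact_mod_cast prismHeight_dist_same k l (by simpa using hxy)
    · obtain ⟨z, hz, hz', h⟩ := prismHeight_dist_of_ne k l
      refine ⟨z, hz, hz', ?_⟩
      rw [configuration, configuration, dist_prismPoint_of_ne_sq _ _ _ _ hij, hb]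
      exact_mod_cast h

/-- For every integer `m ≥ 2`, there exists an integral point set of `2 * m + 17` points in
`ℝ^m` (pairwise integral distances, not contained in any affine hyperplane) whose
diameter is at most `11692`; that is, `d(m, 2 * m + 17) ≤ 11692`. -/
theorem d_bound_stmt_19 :
    ∀ m : ℕ, 2 ≤ m →
      ∃ S : Finset (EuclideanSpace ℝ (Fin m)),
        S.card = 2 * m + 17 ∧
        affineSpan ℝ (S : Set (EuclideanSpace ℝ (Fin m))) = ⊤ ∧
        (∀ p ∈ S, ∀ q ∈ S, ∃ z : ℤ, dist p q = (z : ℝ)) ∧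
        Metric.diam (S : Set (EuclideanSpace ℝ (Fin m))) ≤ 11692 := by
  classical
  intro m hm
  obtain ⟨n, rfl⟩ : ∃ n, m = n + 1 := ⟨m - 1, by omega⟩
  obtain ⟨b, hb0, hb⟩ : ∃ b : ℝ, b ≠ 0 ∧ 2 * b ^ 2 = 1008 ^ 2 := by
    refine ⟨√508032, by positivity, ?_⟩
    rw [Real.sq_sqrt (by norm_num)]
    norm_num
  obtain ⟨c, hcb, hc⟩ := exists_equidistant_diagonal (n := n) (b := b) (D := 4989600)
    (by omega) (by linarith)
  have hdist : ∀ x y, ∃ z : ℕ, z ≤ 11692 ∧ (x ≠ y → 0 < z) ∧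
      dist (configuration n b c x) (configuration n b c y) = z := by
    intro x y
    by_cases hxy : x = y
    · exact ⟨0, by norm_num, fun h => absurd hxy h, by simp [hxy]⟩
    · obtain ⟨z, hz, hz', h⟩ := configuration_dist_sq hb hc x y hxy
      exact ⟨z, hz', fun _ => hz, (pow_left_inj₀ dist_nonneg z.cast_nonneg two_ne_zero).mp h⟩
  have hinj : Function.Injective (configuration n b c) := by
    intro x y hxy
    by_contra hne
    obtain ⟨z, -, hz, h⟩ := hdist x y
    rw [hxy, dist_self] at h
    exact (hz hne).ne (by exact_mod_cast h)
  have hmem : ∀ x, configuration n b c x ∈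
      ((univ.image (configuration n b c) : Finset _) : Set (EuclideanSpace ℝ (Fin (n + 1)))) :=
    fun x => by simp
  refine ⟨univ.image (configuration n b c), ?_, ?_, ?_, ?_⟩
  · rw [card_image_of_injective _ hinj]
    simp
    ring
  · exact affineSpan_eq_top_of_axisPoint_prismPoint (t := axisHeight 0) (t' := axisHeight 1)
      (s := prismHeight 0) hb0 hcb (by simp [axisHeight]) (hmem (.inl 0)) (hmem (.inl 1))
      fun i => hmem (.inr (i, 0))
  · simp only [mem_image, mem_univ, true_and]
    rintro _ ⟨x, rfl⟩ _ ⟨y, rfl⟩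
    obtain ⟨z, -, -, h⟩ := hdist x y
    exact ⟨z, by simpa using h⟩
  · refine Metric.diam_le_of_forall_dist_le (by norm_num) ?_
    simp only [coe_image, coe_univ, Set.image_univ]
    rintro _ ⟨x, rfl⟩ _ ⟨y, rfl⟩
    obtain ⟨z, hz, -, h⟩ := hdist x y
    rw [h]
    exact_mod_cast hz
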